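/- Assume Assumption (Fdec) holds. Let ρ̲ ≤ c ≤ ρ̄ and x₊ ≥ x₀⁺ be given. (i) If x₊ = 0, then X* = 0 is optimal for the positive part problem with parameters ({ρ ≤ c}, x₊) and v₊(c, x₊) = 0. (ii) If x₊ > 0 and c = ρ̲, then the positive part problem has no feasible solution and v₊(c, x₊) = −∞. (iii) If x₊ > 0 and ρ̲ < c ≤ ρ̄, then X*(λ) := (u₊')⁻¹(λρ/T₊'(F(ρ)))·1_{ρ≤c} is an optimal solution of the positive part problem with parameters ({ρ ≤ c}, x₊), where λ > 0 is the unique real number satisfying E[ρ·X*(λ)] = x₊, and the optimal value is v₊(c, x₊) = E[u₊((u₊')⁻¹(λρ/T₊'(F(ρ))))·T₊'(F(ρ))·1_{ρ≤c}]. -/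

import Mathlib

open MeasureTheory Set Filter
open scoped ENNReal symmDiff

noncomputable section

/-- The data of the continuous-time behavioral portfolio selection model:
a probability space, the pricing kernel `ρ`, the utilities `up = u₊`, `um = u₋`
(with the derivatives `up'`, `up''` of `u₊`), the probability distortions
`Tp = T₊`, `Tm = T₋`, and the initial endowment `x0`. -/
structure BSetup (Ω : Type*) [MeasurableSpace Ω] where
  P : MeasureTheory.Measure Ω
  isProb : MeasureTheory.IsProbabilityMeasure P
  ρ : Ω → ℝ
  meas_ρ : Measurable ρ
  ρ_pos : ∀ᵐ ω ∂P, 0 < ρ ω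
  ρ_int : MeasureTheory.Integrable ρ P
  Eρ_pos : 0 < ∫ ω, ρ ω ∂P
  ρ_atomless : ∀ a : ℝ, P {ω | ρ ω = a} = 0
  up : ℝ → ℝ
  um : ℝ → ℝ
  up' : ℝ → ℝ
  up'' : ℝ → ℝ
  up_mono : StrictMonoOn up (Set.Ici 0)
  um_mono : StrictMonoOn um (Set.Ici 0)
  up_concave : ConcaveOn ℝ (Set.Ici 0) up
  um_concave : ConcaveOn ℝ (Set.Ici 0) um
  up_zero : up 0 = 0
  um_zero : um 0 = 0
  up_sconcave : StrictConcaveOn ℝ (Set.Ici 0) up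
  up_deriv : ∀ x ∈ Set.Ioi (0:ℝ), HasDerivAt up (up' x) x
  up_deriv2 : ∀ x ∈ Set.Ioi (0:ℝ), HasDerivAt up' (up'' x) x
  up'_zero : Filter.Tendsto up' (nhdsWithin 0 (Set.Ioi 0)) Filter.atTop
  up'_atTop : Filter.Tendsto up' Filter.atTop (nhds 0)
  Tp : ℝ → ℝ
  Tm : ℝ → ℝ
  Tp_mono : StrictMonoOn Tp (Set.Icc 0 1)
  Tm_mono : StrictMonoOn Tm (Set.Icc 0 1)
  Tp_diff : DifferentiableOn ℝ Tp (Set.Icc 0 1)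
  Tm_diff : DifferentiableOn ℝ Tm (Set.Icc 0 1)
  Tp_zero : Tp 0 = 0
  Tm_zero : Tm 0 = 0
  Tp_one : Tp 1 = 1
  Tm_one : Tm 1 = 1
  x0 : ℝ

variable {Ω : Type*} [MeasurableSpace Ω]

/-- `V₊(Y) = ∫₀^∞ T₊(P{u₊(Y) > y}) dy`, as a value in `[0,∞]`. -/
def Vpl (S : BSetup Ω) (Y : Ω → ℝ) : ℝ≥0∞ :=
  ∫⁻ y in Set.Ioi (0:ℝ), ENNReal.ofReal (S.Tp ((S.P {ω | y < S.up (Y ω)}).toReal))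

/-- `V₋(Y) = ∫₀^∞ T₋(P{u₋(Y) > y}) dy`, as a value in `[0,∞]`. -/
def Vmn (S : BSetup Ω) (Y : Ω → ℝ) : ℝ≥0∞ :=
  ∫⁻ y in Set.Ioi (0:ℝ), ENNReal.ofReal (S.Tm ((S.P {ω | y < S.um (Y ω)}).toReal))

/-- `V(X) = V₊(X⁺) − V₋(X⁻)`, an extended real number. -/
def Vval (S : BSetup Ω) (X : Ω → ℝ) : EReal :=
  (Vpl S (fun ω => max (X ω) 0)).toEReal - (Vmn S (fun ω => max (-X ω) 0)).toEReal

/-- Feasibility for Problem (P): `X` is a random variable, a.s. bounded below,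
with `E[ρX] = x₀`. -/
def FeasP (S : BSetup Ω) (X : Ω → ℝ) : Prop :=
  AEMeasurable X S.P ∧ (∃ b : ℝ, ∀ᵐ ω ∂S.P, b ≤ X ω) ∧
    MeasureTheory.Integrable (fun ω => S.ρ ω * X ω) S.P ∧
    (∫ ω, S.ρ ω * X ω ∂S.P) = S.x0

/-- The supremum value of Problem (P). -/
def supP (S : BSetup Ω) : EReal :=
  sSup {v : EReal | ∃ X : Ω → ℝ, FeasP S X ∧ v = Vval S X}

/-- Problem (P) is ill-posed if its supremum value is `+∞`. -/
def IllposedP (S : BSetup Ω) : Prop := supP S = ⊤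

/-- `X` is an optimal solution of Problem (P). -/
def OptimalP (S : BSetup Ω) (X : Ω → ℝ) : Prop :=
  FeasP S X ∧ ∀ Y : Ω → ℝ, FeasP S Y → Vval S Y ≤ Vval S X

/-- Feasibility for the positive part problem with parameters `(A, x₊)`. -/
def FeasPos (S : BSetup Ω) (A : Set Ω) (xp : ℝ) (X : Ω → ℝ) : Prop :=
  AEMeasurable X S.P ∧ (∀ᵐ ω ∂S.P, 0 ≤ X ω) ∧
    MeasureTheory.Integrable (fun ω => S.ρ ω * X ω) S.P ∧
    (∫ ω, S.ρ ω * X ω ∂S.P) = xp ∧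
    (∀ᵐ ω ∂S.P, ω ∉ A → X ω = 0)

/-- Optimality for the positive part problem with parameters `(A, x₊)`. -/
def OptPos (S : BSetup Ω) (A : Set Ω) (xp : ℝ) (X : Ω → ℝ) : Prop :=
  FeasPos S A xp X ∧ ∀ Y : Ω → ℝ, FeasPos S A xp Y → Vpl S Y ≤ Vpl S X

/-- The value `v₊(A, x₊)` of the positive part problem. -/
def vPos (S : BSetup Ω) (A : Set Ω) (xp : ℝ) : EReal :=
  if S.P A = 0 then (if xp = 0 then 0 else ⊥)
  else sSup {v : EReal | ∃ X : Ω → ℝ, FeasPos S A xp X ∧ v = (Vpl S X).toEReal}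

/-- Feasibility for the negative part problem with parameters `(A, x₊)`. -/
def FeasNeg (S : BSetup Ω) (A : Set Ω) (xp : ℝ) (X : Ω → ℝ) : Prop :=
  AEMeasurable X S.P ∧ (∀ᵐ ω ∂S.P, 0 ≤ X ω) ∧ (∃ b : ℝ, ∀ᵐ ω ∂S.P, X ω ≤ b) ∧
    MeasureTheory.Integrable (fun ω => S.ρ ω * X ω) S.P ∧
    (∫ ω, S.ρ ω * X ω ∂S.P) = xp - S.x0 ∧
    (∀ᵐ ω ∂S.P, ω ∈ A → X ω = 0)

/-- Optimality for the negative part problem with parameters `(A, x₊)`. -/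
def OptNeg (S : BSetup Ω) (A : Set Ω) (xp : ℝ) (X : Ω → ℝ) : Prop :=
  FeasNeg S A xp X ∧ ∀ Y : Ω → ℝ, FeasNeg S A xp Y → Vmn S X ≤ Vmn S Y

/-- The value `v₋(A, x₊)` of the negative part problem. -/
def vNeg (S : BSetup Ω) (A : Set Ω) (xp : ℝ) : EReal :=
  if S.P A = 1 then (if xp = S.x0 then 0 else ⊤)
  else sInf {v : EReal | ∃ X : Ω → ℝ, FeasNeg S A xp X ∧ v = (Vmn S X).toEReal}

/-- Feasibility for Problem (S). -/
def FeasS (S : BSetup Ω) (A : Set Ω) (xp : ℝ) : Prop :=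
  MeasurableSet A ∧ max S.x0 0 ≤ xp ∧ (S.P A = 0 → xp = 0) ∧ (S.P A = 1 → xp = S.x0)

/-- The objective of Problem (S): `v₊(A, x₊) − v₋(A, x₊)`. -/
def objS (S : BSetup Ω) (A : Set Ω) (xp : ℝ) : EReal := vPos S A xp - vNeg S A xp

/-- The supremum value of Problem (S). -/
def supS (S : BSetup Ω) : EReal :=
  sSup {v : EReal | ∃ (A : Set Ω) (xp : ℝ), FeasS S A xp ∧ v = objS S A xp}

/-- Optimality for Problem (S). -/
def OptS (S : BSetup Ω) (A : Set Ω) (xp : ℝ) : Prop :=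
  FeasS S A xp ∧ ∀ (B : Set Ω) (yp : ℝ), FeasS S B yp → objS S B yp ≤ objS S A xp

/-- `ρ̄ = esssup ρ` (an extended real number). -/
def rhoBar (S : BSetup Ω) : EReal := essSup (fun ω => (S.ρ ω : EReal)) S.P

/-- `ρ̲ = essinf ρ` (an extended real number). -/
def rhoLow (S : BSetup Ω) : EReal := essInf (fun ω => (S.ρ ω : EReal)) S.P

/-- The event `{ρ ≤ c}`. -/
def lev (S : BSetup Ω) (c : EReal) : Set Ω := {ω | (S.ρ ω : EReal) ≤ c}

/-- Feasibility of `(c, x₊)` for Problems (S_c) and (M). -/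
def FeasSc (S : BSetup Ω) (c : EReal) (xp : ℝ) : Prop :=
  rhoLow S ≤ c ∧ c ≤ rhoBar S ∧ max S.x0 0 ≤ xp ∧
    (c = rhoLow S → xp = 0) ∧ (c = rhoBar S → xp = S.x0)

/-- The objective of Problem (S_c): `v₊(c, x₊) − v₋(c, x₊)`. -/
def objSc (S : BSetup Ω) (c : EReal) (xp : ℝ) : EReal :=
  vPos S (lev S c) xp - vNeg S (lev S c) xp

/-- Optimality for Problem (S_c). -/
def OptSc (S : BSetup Ω) (c : EReal) (xp : ℝ) : Prop :=
  FeasSc S c xp ∧ ∀ (c' : EReal) (xp' : ℝ), FeasSc S c' xp' → objSc S c' xp' ≤ objSc S c xp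

/-- The supremum value of Problem (S_c). -/
def supSc (S : BSetup Ω) : EReal :=
  sSup {v : EReal | ∃ (c : EReal) (xp : ℝ), FeasSc S c xp ∧ v = objSc S c xp}

/-- The distribution function `F` of `ρ`. -/
def Fdist (S : BSetup Ω) (x : ℝ) : ℝ := (S.P {ω | S.ρ ω ≤ x}).toReal

/-- The distribution function of `ρ` evaluated at an extended real `c`. -/
def FdistE (S : BSetup Ω) (c : EReal) : ℝ := (S.P {ω | (S.ρ ω : EReal) ≤ c}).toReal

/-- `E[ρ·1_{ρ>c}]`. -/
def ERhoGt (S : BSetup Ω) (c : EReal) : ℝ :=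
  ∫ ω, (if c < (S.ρ ω : EReal) then S.ρ ω else 0) ∂S.P

/-- The objective of Problem (M):
`v₊(c, x₊) − u₋((x₊−x₀)/E[ρ1_{ρ>c}])·T₋(1−F(c))`.  (When `c = ρ̄` and `x₊ = x₀`
the subtracted term vanishes, realizing the convention of the paper.) -/
def objM (S : BSetup Ω) (c : EReal) (xp : ℝ) : EReal :=
  vPos S (lev S c) xp -
    ((S.um ((xp - S.x0) / ERhoGt S c) * S.Tm (1 - FdistE S c) : ℝ) : EReal)

/-- Optimality for Problem (M). -/
def OptM (S : BSetup Ω) (c : EReal) (xp : ℝ) : Prop :=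
  FeasSc S c xp ∧ ∀ (c' : EReal) (xp' : ℝ), FeasSc S c' xp' → objM S c' xp' ≤ objM S c xp

/-- The supremum value of Problem (M). -/
def supM (S : BSetup Ω) : EReal :=
  sSup {v : EReal | ∃ (c : EReal) (xp : ℝ), FeasSc S c xp ∧ v = objM S c xp}

/-- The generalized inverse `F⁻¹(z) = inf{y ≥ 0 : F(y) ≥ z}` of the distribution
function of `ρ`, valued in the extended reals (`= +∞` if no such `y` exists). -/
def FinvE (S : BSetup Ω) (z : ℝ) : EReal :=
  sInf {c : EReal | ∃ y : ℝ, 0 ≤ y ∧ z ≤ Fdist S y ∧ c = (y : EReal)}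

/-- The finiteness condition: `V₊(X) < ∞` whenever `X ≥ 0` a.s. and `E[ρX] < ∞`. -/
def FinCond (S : BSetup Ω) : Prop :=
  ∀ X : Ω → ℝ, AEMeasurable X S.P → (∀ᵐ ω ∂S.P, 0 ≤ X ω) →
    MeasureTheory.Integrable (fun ω => S.ρ ω * X ω) S.P → Vpl S X < ⊤

/-- `u` is strictly concave at `0`: `u(λx) > λu(x)` for `x > 0`, `λ ∈ (0,1)`. -/
def StrictConcaveAtZero (u : ℝ → ℝ) : Prop :=
  ∀ x : ℝ, 0 < x → ∀ l : ℝ, 0 < l → l < 1 → l * u x < u (l * x)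

namespace BSetup

lemma up'_strictAntiOn (S : BSetup Ω) : StrictAntiOn S.up' (Ioi 0) := by
  have h : StrictAntiOn (deriv S.up) (Ioi 0) :=
    (S.up_sconcave.subset Ioi_subset_Ici_self (convex_Ioi 0)).strictAntiOn_deriv
      fun x hx => (S.up_deriv x hx).differentiableAt
  intro x hx y hy hxy
  rw [← (S.up_deriv x hx).deriv, ← (S.up_deriv y hy).deriv]
  exact h hx hy hxy

lemma up'_pos (S : BSetup Ω) {x : ℝ} (hx : 0 < x) : 0 < S.up' x := by
  have hx1 : 0 < x + 1 := by linarith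
  refine lt_of_le_of_lt ?_ (S.up'_strictAntiOn hx hx1 (lt_add_one x))
  refine le_of_tendsto S.up'_atTop ?_
  filter_upwards [eventually_ge_atTop (x + 1)] with y hy
  exact S.up'_strictAntiOn.antitoneOn hx1 (hx1.trans_le hy) hy

lemma up_nonneg (S : BSetup Ω) {x : ℝ} (hx : 0 ≤ x) : 0 ≤ S.up x := by
  rw [← S.up_zero]
  exact S.up_mono.monotoneOn self_mem_Ici hx hx

lemma up_pos (S : BSetup Ω) {x : ℝ} (hx : 0 < x) : 0 < S.up x := by
  rw [← S.up_zero]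
  exact S.up_mono self_mem_Ici hx.le hx

lemma mul_up'_le (S : BSetup Ω) {x : ℝ} (hx : 0 < x) : x * S.up' x ≤ S.up x := by
  have h := S.up_concave.le_slope_of_hasDerivAt (self_mem_Ici (a := (0:ℝ))) (mem_Ici.2 hx.le) hx
    (S.up_deriv x hx)
  rwa [slope_def_field, S.up_zero, sub_zero, sub_zero, le_div_iff₀ hx, mul_comm] at h

/-- `I` is the inverse of the marginal utility `u₊'` on `(0,∞)`. -/
def IsInvUp' (S : BSetup Ω) (I : ℝ → ℝ) : Prop :=
  ∀ y : ℝ, 0 < y → 0 < I y ∧ S.up' (I y) = y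

namespace IsInvUp'

variable {S : BSetup Ω} {I : ℝ → ℝ}

lemma apply_up' (hI : S.IsInvUp' I) {x : ℝ} (hx : 0 < x) : I (S.up' x) = x :=
  S.up'_strictAntiOn.injOn (hI _ (S.up'_pos hx)).1 hx (hI _ (S.up'_pos hx)).2

lemma lt_iff (hI : S.IsInvUp' I) {x y : ℝ} (hx : 0 < x) (hy : 0 < y) :
    x < I y ↔ y < S.up' x := by
  have h := S.up'_strictAntiOn.lt_iff_gt (hI y hy).1 (mem_Ioi.2 hx)
  rw [(hI y hy).2] at h
  exact h.symm

lemma strictAntiOn (hI : S.IsInvUp' I) : StrictAntiOn I (Ioi 0) := by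
  intro x hx y hy hxy
  rwa [hI.lt_iff (hI y hy).1 hx, (hI y hy).2]

lemma image_Ioi (hI : S.IsInvUp' I) : I '' Ioi 0 = Ioi 0 := by
  ext x
  constructor
  · rintro ⟨y, hy, rfl⟩
    exact (hI y hy).1
  · exact fun hx => ⟨S.up' x, S.up'_pos hx, hI.apply_up' hx⟩

lemma continuousAt (hI : S.IsInvUp' I) {y : ℝ} (hy : 0 < y) : ContinuousAt I y := by
  have h : ContinuousAt (fun y => -I y) y := by
    refine continuousAt_of_monotoneOn_of_image_mem_nhds (s := Ioi 0)
      (fun a ha b hb hab => neg_le_neg (hI.strictAntiOn.antitoneOn ha hb hab)) (Ioi_mem_nhds hy) ?_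
    have : (fun y => -I y) '' Ioi 0 = Iio 0 := by
      rw [← image_image (fun z : ℝ => -z) I, hI.image_Ioi]
      simp
    rw [this]
    exact Iio_mem_nhds (by linarith [(hI y hy).1])
  simpa only [neg_neg] using h.fun_neg

lemma measurable_indicator (hI : S.IsInvUp' I) : Measurable ((Ioi 0).indicator I) := by
  classical
  rw [← piecewise_eq_indicator]
  exact ContinuousOn.measurable_piecewise
    (fun y hy => (hI.continuousAt hy).continuousWithinAt) continuousOn_const measurableSet_Ioi

lemma tendsto_atTop (hI : S.IsInvUp' I) : Tendsto I atTop (nhds 0) := by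
  rw [tendsto_order]
  constructor
  · intro a ha
    filter_upwards [eventually_gt_atTop 0] with y hy using ha.trans (hI y hy).1
  · intro a ha
    filter_upwards [eventually_gt_atTop (S.up' a)] with y hy
    have hy0 := (S.up'_pos ha).trans hy
    by_contra! h
    rcases h.lt_or_eq with h | h
    · exact absurd ((hI.lt_iff ha hy0).1 h) hy.le.not_gt
    · exact absurd (by rw [h, (hI y hy0).2]) hy.ne

lemma mul_le_up (hI : S.IsInvUp' I) {y : ℝ} (hy : 0 < y) : y * I y ≤ S.up (I y) := by
  have := S.mul_up'_le (hI y hy).1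
  rwa [(hI y hy).2, mul_comm] at this

/-- If the relative risk aversion is bounded away from zero at infinity, then `I` grows at most
polynomially at zero. -/
lemma exists_le_mul_add (hI : S.IsInvUp' I)
    (hrisk : 0 < Filter.liminf (fun x : ℝ => -x * S.up'' x / S.up' x) Filter.atTop)
    {l : ℝ} (hl : 0 < l) :
    ∃ k C : ℝ, 0 ≤ k ∧ ∀ y, 0 < y → I (l * y) ≤ k * I y + C := by
  obtain ⟨a, ha, hev⟩ : ∃ a, 0 < a ∧ ∀ᶠ x in atTop, a ≤ -x * S.up'' x / S.up' x := by
    rw [liminf_eq] at hrisk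
    by_contra h
    refine hrisk.not_ge (Real.sSup_nonpos fun a ha => ?_)
    by_contra! h'
    exact h ⟨a, h', ha⟩
  obtain ⟨x₁, hx₁, hx⟩ : ∃ x₁ : ℝ, 0 < x₁ ∧ ∀ x ≥ x₁, a * S.up' x + x * S.up'' x ≤ 0 := by
    obtain ⟨b, hb⟩ := eventually_atTop.1 hev
    refine ⟨max b 1, by positivity, fun x hx => ?_⟩
    have hx0 : 0 < x := lt_of_lt_of_le (by positivity) hx
    have := (le_div_iff₀ (S.up'_pos hx0)).1 (hb x ((le_max_left _ _).trans hx))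
    linarith
  have hderiv : ∀ x, 0 < x → HasDerivAt (fun x => x ^ a * S.up' x)
      (a * x ^ (a - 1) * S.up' x + x ^ a * S.up'' x) x := fun x hx =>
    (Real.hasDerivAt_rpow_const (Or.inl hx.ne')).mul (S.up_deriv2 x hx)
  have hanti : AntitoneOn (fun x => x ^ a * S.up' x) (Ici x₁) := by
    refine antitoneOn_of_deriv_nonpos (convex_Ici x₁) ?_ ?_ ?_
    · exact fun x hx => (hderiv x (hx₁.trans_le hx)).continuousAt.continuousWithinAt
    · intro x hx
      rw [interior_Ici] at hx
      exact (hderiv x (hx₁.trans hx)).differentiableAt.differentiableWithinAt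
    · intro x hx'
      rw [interior_Ici] at hx'
      have hx0 : 0 < x := hx₁.trans hx'
      rw [(hderiv x hx0).deriv]
      have h1 : x ^ a = x ^ (a - 1) * x := by
        rw [← Real.rpow_add_one hx0.ne', sub_add_cancel]
      have h2 : a * x ^ (a - 1) * S.up' x + x ^ a * S.up'' x
          = x ^ (a - 1) * (a * S.up' x + x * S.up'' x) := by rw [h1]; ring
      rw [h2]
      exact mul_nonpos_of_nonneg_of_nonpos (by positivity) (hx x (le_of_lt hx'))
  rcases le_or_gt 1 l with h1l | hl1
  · refine ⟨1, 0, zero_le_one, fun y hy => ?_⟩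
    rw [one_mul, add_zero]
    exact hI.strictAntiOn.antitoneOn hy (mul_pos hl hy) (le_mul_of_one_le_left hy.le h1l)
  set k : ℝ := l ^ (-a⁻¹) with hk
  have hk1 : 1 ≤ k := Real.one_le_rpow_of_pos_of_le_one_of_nonpos hl hl1.le (by simpa using ha.le)
  have hk0 : 0 < k := by positivity
  have hka : k ^ a * l = 1 := by
    rw [hk, ← Real.rpow_mul hl.le, neg_mul, inv_mul_cancel₀ ha.ne', Real.rpow_neg_one,
      inv_mul_cancel₀ hl.ne']
  have hC : 0 < l * S.up' x₁ := mul_pos hl (S.up'_pos hx₁)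
  refine ⟨k, I (l * S.up' x₁), hk0.le, fun y hy => ?_⟩
  have hly := mul_pos hl hy
  have hIy := (hI y hy).1
  rcases le_or_gt x₁ (I y) with h | h
  · have h3 := hanti h (h.trans (le_mul_of_one_le_left hIy.le hk1))
      (le_mul_of_one_le_left hIy.le hk1)
    simp only [Real.mul_rpow hk0.le hIy.le, (hI y hy).2] at h3
    have h4 : S.up' (k * I y) ≤ l * y := by
      have h5 : 0 < I y ^ a := by positivity
      have h6 : k ^ a * S.up' (k * I y) ≤ y := by
        refine le_of_mul_le_mul_left ?_ h5
        linarith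
      calc S.up' (k * I y) = l * (k ^ a * S.up' (k * I y)) := by
            linear_combination -S.up' (k * I y) * hka
        _ ≤ l * y := by gcongr
    have h7 : I (l * y) ≤ k * I y := by
      by_contra! h8
      exact absurd ((hI.lt_iff (mul_pos hk0 hIy) hly).1 h8) h4.not_gt
    linarith [(hI _ hC).1]
  · have h3 : S.up' x₁ ≤ y := by
      rw [← (hI y hy).2]
      exact (S.up'_strictAntiOn hIy (mem_Ioi.2 hx₁) h).le
    have h4 : I (l * y) ≤ I (l * S.up' x₁) :=
      hI.strictAntiOn.antitoneOn hC hly (by gcongr)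
    nlinarith [mul_pos hk0 hIy]

end IsInvUp'

instance (S : BSetup Ω) : IsProbabilityMeasure S.P := S.isProb

lemma Fdist_eq_cdf (S : BSetup Ω) : Fdist S = ProbabilityTheory.cdf (S.P.map S.ρ) := by
  have := Measure.isProbabilityMeasure_map (μ := S.P) S.meas_ρ.aemeasurable
  ext x
  rw [ProbabilityTheory.cdf_eq_real, map_measureReal_apply S.meas_ρ measurableSet_Iic]
  rfl

lemma Fdist_mono (S : BSetup Ω) : Monotone (Fdist S) := by
  rw [Fdist_eq_cdf]
  exact ProbabilityTheory.monotone_cdf _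

lemma Fdist_nonneg (S : BSetup Ω) (x : ℝ) : 0 ≤ Fdist S x := ENNReal.toReal_nonneg

lemma Fdist_le_one (S : BSetup Ω) (x : ℝ) : Fdist S x ≤ 1 := measureReal_le_one

lemma ofReal_Fdist (S : BSetup Ω) (x : ℝ) :
    ENNReal.ofReal (Fdist S x) = S.P {ω | S.ρ ω ≤ x} :=
  ENNReal.ofReal_toReal (measure_ne_top _ _)

lemma continuous_Fdist (S : BSetup Ω) : Continuous (Fdist S) := by
  have := Measure.isProbabilityMeasure_map (μ := S.P) S.meas_ρ.aemeasurable
  rw [Fdist_eq_cdf]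
  set G := ProbabilityTheory.cdf (S.P.map S.ρ) with hG
  refine continuous_iff_continuousAt.2 fun a => ?_
  rw [continuousAt_iff_continuous_left'_right']
  refine ⟨?_, (G.right_continuous a).mono Ioi_subset_Ici_self⟩
  rw [G.mono.continuousWithinAt_Iio_iff_leftLim_eq]
  have h1 : G.measure {a} = 0 := by
    rw [hG, ProbabilityTheory.measure_cdf, Measure.map_apply S.meas_ρ (measurableSet_singleton a)]
    exact S.ρ_atomless a
  rw [StieltjesFunction.measure_singleton, ENNReal.ofReal_eq_zero, sub_nonpos] at h1
  exact le_antisymm (G.mono.leftLim_le le_rfl) h1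

lemma exists_Fdist_eq (S : BSetup Ω) {p : ℝ} (h0 : 0 < p) (h1 : p < 1) : ∃ r, Fdist S r = p := by
  have hbot : Tendsto (Fdist S) atBot (nhds 0) := by
    rw [Fdist_eq_cdf]; exact ProbabilityTheory.tendsto_cdf_atBot _
  have htop : Tendsto (Fdist S) atTop (nhds 1) := by
    rw [Fdist_eq_cdf]; exact ProbabilityTheory.tendsto_cdf_atTop _
  obtain ⟨a, ha⟩ := (hbot.eventually (gt_mem_nhds h0)).exists
  obtain ⟨b, hb⟩ := (htop.eventually (lt_mem_nhds h1)).exists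
  exact mem_range_of_exists_le_of_exists_ge S.continuous_Fdist ⟨a, ha.le⟩ ⟨b, hb.le⟩

lemma measurable_Fdist_ρ (S : BSetup Ω) : Measurable fun ω => Fdist S (S.ρ ω) :=
  S.continuous_Fdist.measurable.comp S.meas_ρ

lemma measure_Fdist_ρ_le (S : BSetup Ω) {p : ℝ} (h0 : 0 ≤ p) (h1 : p ≤ 1) :
    S.P {ω | Fdist S (S.ρ ω) ≤ p} = ENNReal.ofReal p := by
  rcases h1.eq_or_lt with rfl | h1
  · simp [Fdist_le_one]
  refine le_antisymm ?_ ?_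
  · rw [← ofReal_measureReal]
    refine ENNReal.ofReal_le_ofReal (le_of_forall_gt_imp_ge_of_dense fun q hq => ?_)
    rcases le_or_gt 1 q with hq1 | hq1
    · exact measureReal_le_one.trans hq1
    obtain ⟨r, rfl⟩ := S.exists_Fdist_eq (h0.trans_lt hq) hq1
    refine measureReal_mono fun ω hω => ?_
    by_contra! h
    exact absurd ((S.Fdist_mono (le_of_lt (not_le.1 h))).trans hω) hq.not_ge
  · rcases h0.eq_or_lt with rfl | h0
    · simp
    obtain ⟨r, rfl⟩ := S.exists_Fdist_eq h0 h1
    rw [ofReal_Fdist]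
    exact measure_mono fun ω hω => S.Fdist_mono hω

lemma map_Fdist_ρ (S : BSetup Ω) :
    S.P.map (fun ω => Fdist S (S.ρ ω)) = volume.restrict (Icc 0 1) := by
  have := Measure.isProbabilityMeasure_map (μ := S.P) S.measurable_Fdist_ρ.aemeasurable
  refine Measure.ext_of_Iic _ _ fun a => ?_
  rw [Measure.map_apply S.measurable_Fdist_ρ measurableSet_Iic,
    Measure.restrict_apply measurableSet_Iic]
  rcases lt_or_ge a 0 with ha | ha
  · have h1 : (fun ω => Fdist S (S.ρ ω)) ⁻¹' Iic a = ∅ :=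
      eq_empty_of_forall_notMem fun ω hω => (ha.trans_le (S.Fdist_nonneg _)).not_ge hω
    have h2 : Iic a ∩ Icc (0:ℝ) 1 = ∅ :=
      eq_empty_of_forall_notMem fun ω hω => (ha.trans_le hω.2.1).not_ge hω.1
    rw [h1, h2, measure_empty, measure_empty]
  rcases le_or_gt a 1 with ha1 | ha1
  · have h2 : Iic a ∩ Icc (0:ℝ) 1 = Icc 0 a := by
      ext x
      simp only [mem_inter_iff, mem_Iic, mem_Icc]
      constructor
      · tauto
      · exact fun h => ⟨h.2, h.1, h.2.trans ha1⟩
    rw [h2, Real.volume_Icc, sub_zero]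
    exact S.measure_Fdist_ρ_le ha ha1
  · have h1 : (fun ω => Fdist S (S.ρ ω)) ⁻¹' Iic a = univ :=
      eq_univ_of_forall fun ω => (S.Fdist_le_one _).trans ha1.le
    have h2 : Iic a ∩ Icc (0:ℝ) 1 = Icc 0 1 :=
      inter_eq_right.2 fun x hx => hx.2.trans ha1.le
    rw [h1, h2, measure_univ, Real.volume_Icc]
    simp

/-- An outcome at which `ρ` is positive, `0 < F(ρ) < 1`, and `F` is not constant on any left
neighbourhood of `ρ`. -/
def Regular (S : BSetup Ω) (ω : Ω) : Prop :=
  0 < S.ρ ω ∧ 0 < Fdist S (S.ρ ω) ∧ Fdist S (S.ρ ω) < 1 ∧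
    ∀ q : ℚ, (q : ℝ) < S.ρ ω → Fdist S q < Fdist S (S.ρ ω)

lemma ae_regular (S : BSetup Ω) : ∀ᵐ ω ∂S.P, S.Regular ω := by
  have h01 : ∀ᵐ ω ∂S.P, Fdist S (S.ρ ω) ∈ Ioo (0:ℝ) 1 := by
    refine ae_of_ae_map (p := fun z => z ∈ Ioo (0:ℝ) 1) S.measurable_Fdist_ρ.aemeasurable ?_
    rw [S.map_Fdist_ρ, ← restrict_Ioo_eq_restrict_Icc]
    exact ae_restrict_mem measurableSet_Ioo
  have hq : ∀ᵐ ω ∂S.P, ∀ q : ℚ, (q : ℝ) < S.ρ ω → Fdist S q < Fdist S (S.ρ ω) := by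
    refine ae_all_iff.2 fun q => ?_
    have hsub : {ω | S.ρ ω ≤ q} ⊆ {ω | Fdist S (S.ρ ω) ≤ Fdist S q} := fun ω hω => S.Fdist_mono hω
    have heq : {ω | S.ρ ω ≤ q} =ᵐ[S.P] {ω | Fdist S (S.ρ ω) ≤ Fdist S q} := by
      refine ae_eq_of_subset_of_measure_ge hsub ?_
        (measurableSet_le S.meas_ρ measurable_const).nullMeasurableSet (measure_ne_top _ _)
      rw [S.measure_Fdist_ρ_le (S.Fdist_nonneg _) (S.Fdist_le_one _), ofReal_Fdist]
    filter_upwards [heq.mem_iff] with ω hω hlt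
    by_contra! h
    exact hlt.not_ge (hω.2 h)
  filter_upwards [S.ρ_pos, h01, hq] with ω h1 h2 h3
  exact ⟨h1, h2.1, h2.2, h3⟩

lemma Regular.FinvE_Fdist {S : BSetup Ω} {ω : Ω} (h : S.Regular ω) :
    FinvE S (Fdist S (S.ρ ω)) = S.ρ ω := by
  refine le_antisymm (sInf_le ⟨S.ρ ω, h.1.le, le_rfl, rfl⟩) (le_sInf ?_)
  rintro _ ⟨y, -, hy, rfl⟩
  rw [EReal.coe_le_coe_iff]
  by_contra! hlt
  obtain ⟨q, hq1, hq2⟩ := exists_rat_btwn hlt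
  exact (h.2.2.2 q hq2).not_ge (hy.trans (S.Fdist_mono hq1.le))

/-- Up to outcomes that are not regular, the event `A` is a lower level set of `ρ`. -/
def IsLowerEvent (S : BSetup Ω) (A : Set Ω) : Prop :=
  ∀ ω ω', S.Regular ω → S.Regular ω' → ω ∈ A → S.ρ ω' ≤ S.ρ ω → ω' ∈ A

lemma isLowerEvent_lev (S : BSetup Ω) (c : EReal) : S.IsLowerEvent (lev S c) :=
  fun _ _ _ _ h h' => (EReal.coe_le_coe_iff.2 h').trans h

lemma measurableSet_lev (S : BSetup Ω) (c : EReal) : MeasurableSet (lev S c) :=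
  measurableSet_le S.meas_ρ.coe_real_ereal measurable_const

lemma IsLowerEvent.ae_eq {S : BSetup Ω} {A : Set Ω} (hA : S.IsLowerEvent A)
    (hmeas : NullMeasurableSet A S.P) :
    A =ᵐ[S.P] {ω | Fdist S (S.ρ ω) ≤ S.P.real A} := by
  refine ae_eq_of_ae_subset_of_measure_ge ?_ ?_ hmeas (measure_ne_top _ _)
  · filter_upwards [S.ae_regular] with ω hω hωA
    refine (ENNReal.toReal_le_toReal (measure_ne_top _ _) (measure_ne_top _ _)).2 ?_
    refine measure_mono_ae ?_
    filter_upwards [S.ae_regular] with ω' hω' hle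
    exact hA ω ω' hω hω' hωA hle
  · rw [S.measure_Fdist_ρ_le measureReal_nonneg measureReal_le_one, ofReal_measureReal]

lemma lev_bot (S : BSetup Ω) : lev S ⊥ = ∅ := by
  ext ω; simp [lev]

lemma lev_top (S : BSetup Ω) : lev S ⊤ = univ := by
  ext ω; simp [lev]

lemma lev_coe (S : BSetup Ω) (r : ℝ) : lev S r = {ω | S.ρ ω ≤ r} := by
  ext ω; simp [lev]

lemma exists_measure_lev_eq (S : BSetup Ω) (A : Set Ω) : ∃ b, S.P (lev S b) = S.P A := by
  rcases eq_or_ne (S.P A) 0 with h0 | h0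
  · exact ⟨⊥, by rw [S.lev_bot, h0, measure_empty]⟩
  rcases (prob_le_one (μ := S.P) (s := A)).eq_or_lt with h1 | h1
  · exact ⟨⊤, by rw [S.lev_top, h1, measure_univ]⟩
  obtain ⟨r, hr⟩ := S.exists_Fdist_eq (ENNReal.toReal_pos h0 h1.ne_top)
    ((ENNReal.toReal_lt_toReal h1.ne_top ENNReal.one_ne_top).2 h1)
  refine ⟨r, ?_⟩
  rw [S.lev_coe, ← ofReal_Fdist, hr, ENNReal.ofReal_toReal h1.ne_top]

/-- The measure with density `ρ` with respect to `P`. -/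
def priceMeasure (S : BSetup Ω) : Measure Ω := S.P.withDensity fun ω => ENNReal.ofReal (S.ρ ω)

lemma priceMeasure_ac (S : BSetup Ω) : S.priceMeasure ≪ S.P := withDensity_absolutelyContinuous _ _

instance (S : BSetup Ω) : IsFiniteMeasure S.priceMeasure :=
  isFiniteMeasure_withDensity_ofReal S.ρ_int.2

/-- Among events of a given probability, the lower level sets of `ρ` are the cheapest. -/
lemma priceMeasure_lev_le (S : BSetup Ω) {A : Set Ω} (hA : NullMeasurableSet A S.P) {b : EReal}
    (hb : S.P (lev S b) = S.P A) : S.priceMeasure (lev S b) ≤ S.priceMeasure A := by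
  induction b with
  | bot => simp [lev_bot]
  | top =>
    rw [S.lev_top, measure_univ, eq_comm] at hb
    have h : A =ᵐ[S.P] univ := by
      rw [eventuallyEq_univ]
      exact (prob_compl_eq_zero_iff₀ hA).2 hb
    rw [S.lev_top, measure_congr (S.priceMeasure_ac.ae_le h)]
  | coe b =>
    set B := lev S (b : EReal) with hB
    have hBm := S.measurableSet_lev (b : EReal)
    have hA' : NullMeasurableSet A S.priceMeasure := hA.mono_ac S.priceMeasure_ac
    have hdiff : S.P (B \ A) = S.P (A \ B) := by
      rw [← measure_inter_add_sdiff₀ B hA, ← measure_inter_add_sdiff A hBm, inter_comm B A] at hb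
      exact (ENNReal.add_right_inj (measure_ne_top _ _)).1 hb
    rw [← measure_inter_add_sdiff₀ B hA', ← measure_inter_add_sdiff A hBm, inter_comm B A]
    gcongr 1
    simp only [priceMeasure, withDensity_apply']
    calc ∫⁻ ω in B \ A, ENNReal.ofReal (S.ρ ω) ∂S.P
        ≤ ∫⁻ _ in B \ A, ENNReal.ofReal b ∂S.P := by
          refine setLIntegral_mono measurable_const fun ω hω => ?_
          have := hω.1
          rw [hB, lev_coe] at this
          exact ENNReal.ofReal_le_ofReal this
      _ = ∫⁻ _ in A \ B, ENNReal.ofReal b ∂S.P := by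
          rw [setLIntegral_const, setLIntegral_const, hdiff]
      _ ≤ ∫⁻ ω in A \ B, ENNReal.ofReal (S.ρ ω) ∂S.P := by
          refine setLIntegral_mono S.meas_ρ.ennreal_ofReal fun ω hω => ?_
          have := hω.2
          rw [hB, lev_coe] at this
          exact ENNReal.ofReal_le_ofReal (not_le.1 this).le

/-- `Tp'` is the derivative of the distortion `T₊` on `[0,1]`. -/
def IsDerivTp (S : BSetup Ω) (Tp' : ℝ → ℝ) : Prop :=
  ∀ x ∈ Set.Icc (0:ℝ) 1, HasDerivWithinAt S.Tp (Tp' x) (Set.Icc 0 1) x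

/-- `F⁻¹/T₊'` is nondecreasing on `(0,1]`. -/
def MonoRatio (S : BSetup Ω) (Tp' : ℝ → ℝ) : Prop :=
  ∀ z₁ z₂ : ℝ, 0 < z₁ → z₁ ≤ z₂ → z₂ ≤ 1 →
    FinvE S z₁ * ((Tp' z₂ : ℝ) : EReal) ≤ FinvE S z₂ * ((Tp' z₁ : ℝ) : EReal)

/-- The measure with density `T₊'(F(ρ))` with respect to `P`. -/
def distMeasure (S : BSetup Ω) (Tp' : ℝ → ℝ) : Measure Ω :=
  S.P.withDensity fun ω => ENNReal.ofReal (Tp' (Fdist S (S.ρ ω)))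

lemma distMeasure_ac (S : BSetup Ω) (Tp' : ℝ → ℝ) : S.distMeasure Tp' ≪ S.P :=
  withDensity_absolutelyContinuous _ _

namespace IsDerivTp

variable {S : BSetup Ω} {Tp' : ℝ → ℝ}

lemma hasDerivAt (hT : S.IsDerivTp Tp') {x : ℝ} (hx : x ∈ Ioo (0:ℝ) 1) :
    HasDerivAt S.Tp (Tp' x) x :=
  (hT x (Ioo_subset_Icc_self hx)).hasDerivAt (Icc_mem_nhds hx.1 hx.2)

lemma nonneg (hT : S.IsDerivTp Tp') {x : ℝ} (hx : x ∈ Icc (0:ℝ) 1) : 0 ≤ Tp' x := by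
  rw [← (hT x hx).derivWithin (uniqueDiffOn_Icc zero_lt_one x hx)]
  exact S.Tp_mono.monotoneOn.derivWithin_nonneg

lemma setLIntegral_Icc (hT : S.IsDerivTp Tp') {p : ℝ} (h0 : 0 ≤ p) (h1 : p ≤ 1) :
    ∫⁻ z in Icc 0 p, ENNReal.ofReal (Tp' z) = ENNReal.ofReal (S.Tp p) := by
  have hcont : ContinuousOn S.Tp (Icc 0 p) := fun x hx =>
    (hT x ⟨hx.1, hx.2.trans h1⟩).continuousWithinAt.mono (Icc_subset_Icc_right h1)
  have hderiv : ∀ x ∈ Ioo 0 p, HasDerivAt S.Tp (Tp' x) x :=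
    fun x hx => hT.hasDerivAt ⟨hx.1, hx.2.trans_le h1⟩
  have hnn : ∀ x ∈ Icc 0 p, 0 ≤ Tp' x := fun x hx => hT.nonneg ⟨hx.1, hx.2.trans h1⟩
  have hint : IntegrableOn Tp' (Ioc 0 p) :=
    intervalIntegral.integrableOn_deriv_of_nonneg hcont hderiv
      fun x hx => hnn x (Ioo_subset_Icc_self hx)
  have hftc := intervalIntegral.integral_eq_sub_of_hasDerivAt_of_le h0 hcont hderiv
    ((intervalIntegrable_iff_integrableOn_Ioc_of_le h0).2 hint)
  rw [S.Tp_zero, sub_zero, intervalIntegral.integral_of_le h0] at hftc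
  rw [← hftc, ← restrict_Ioc_eq_restrict_Icc, ofReal_integral_eq_lintegral_ofReal hint]
  exact (ae_restrict_mem measurableSet_Ioc).mono fun x hx => hnn x (Ioc_subset_Icc_self hx)

lemma ae_eq_deriv (hT : S.IsDerivTp Tp') :
    (fun ω => Tp' (Fdist S (S.ρ ω))) =ᵐ[S.P] fun ω => deriv S.Tp (Fdist S (S.ρ ω)) := by
  filter_upwards [S.ae_regular] with ω hω
  exact (hT.hasDerivAt ⟨hω.2.1, hω.2.2.1⟩).deriv.symm

lemma aemeasurable (hT : S.IsDerivTp Tp') : AEMeasurable (fun ω => Tp' (Fdist S (S.ρ ω))) S.P :=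
  ⟨_, (measurable_deriv S.Tp).comp S.measurable_Fdist_ρ, hT.ae_eq_deriv⟩

lemma distMeasure_lower (hT : S.IsDerivTp Tp') {A : Set Ω} (hA : S.IsLowerEvent A)
    (hmeas : NullMeasurableSet A S.P) :
    S.distMeasure Tp' A = ENNReal.ofReal (S.Tp (S.P.real A)) := by
  have h0 : 0 ≤ S.P.real A := measureReal_nonneg
  have h1 : S.P.real A ≤ 1 := measureReal_le_one
  rw [measure_congr ((S.distMeasure_ac Tp').ae_le (hA.ae_eq hmeas)), ← hT.setLIntegral_Icc h0 h1,
    distMeasure, withDensity_apply']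
  have h2 : ∫⁻ ω in {ω | Fdist S (S.ρ ω) ≤ S.P.real A}, ENNReal.ofReal (Tp' (Fdist S (S.ρ ω))) ∂S.P
      = ∫⁻ ω in (fun ω => Fdist S (S.ρ ω)) ⁻¹' Iic (S.P.real A),
        ENNReal.ofReal (deriv S.Tp (Fdist S (S.ρ ω))) ∂S.P := by
    refine lintegral_congr_ae (ae_restrict_of_ae ?_)
    filter_upwards [hT.ae_eq_deriv] with ω hω
    rw [hω]
  rw [h2, ← setLIntegral_map (f := fun z => ENNReal.ofReal (deriv S.Tp z)) measurableSet_Iic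
    (measurable_deriv S.Tp).ennreal_ofReal S.measurable_Fdist_ρ, S.map_Fdist_ρ,
    Measure.restrict_restrict measurableSet_Iic]
  have h3 : Iic (S.P.real A) ∩ Icc (0:ℝ) 1 = Icc 0 (S.P.real A) := by
    ext x
    simp only [mem_inter_iff, mem_Iic, mem_Icc]
    exact ⟨fun h => ⟨h.2.1, h.1⟩, fun h => ⟨h.2, h.1, h.2.trans h1⟩⟩
  rw [h3, ← restrict_Ioo_eq_restrict_Icc]
  refine setLIntegral_congr_fun measurableSet_Ioo fun x hx => ?_
  rw [(hT.hasDerivAt ⟨hx.1, hx.2.trans_le h1⟩).deriv]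

/-- Every positive value of `F⁻¹` on `(0,1)` comes with a positive derivative of `T₊`. -/
lemma pos_of_Finv (hT : S.IsDerivTp Tp') (hF : S.MonoRatio Tp')
    {z : ℝ} (h0 : 0 < z) (h1 : z < 1) (hz : 0 < FinvE S z) : 0 < Tp' z := by
  refine (hT.nonneg ⟨h0.le, h1.le⟩).lt_of_ne fun hzero => ?_
  have hall : ∀ x ∈ Icc z 1, Tp' x = 0 := by
    intro x hx
    refine le_antisymm ?_ (hT.nonneg ⟨h0.le.trans hx.1, hx.2⟩)
    by_contra! hpos
    have h := hF z x h0 hx.1 hx.2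
    rw [← hzero, EReal.coe_zero, mul_zero] at h
    exact (EReal.mul_pos hz (EReal.coe_pos.2 hpos)).not_ge h
  have hsub : Icc z 1 ⊆ Icc 0 1 := Icc_subset_Icc_left h0.le
  have hconst := constant_of_derivWithin_zero (f := S.Tp) (a := z) (b := 1)
    (fun x hx => ((hT x (hsub hx)).mono hsub).differentiableWithinAt)
    (fun x hx => by
      have hx' := Ico_subset_Icc_self hx
      rw [((hT x (hsub hx')).mono hsub).derivWithin (uniqueDiffOn_Icc h1 x hx'), hall x hx'])
    1 ⟨h1.le, le_rfl⟩
  exact (S.Tp_mono ⟨h0.le, h1.le⟩ ⟨zero_le_one, le_rfl⟩ h1).ne' hconst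

end IsDerivTp

/-- The likelihood ratio `ρ / T₊'(F(ρ))`. -/
def ratio (S : BSetup Ω) (Tp' : ℝ → ℝ) (ω : Ω) : ℝ := S.ρ ω / Tp' (Fdist S (S.ρ ω))

namespace Regular

variable {S : BSetup Ω} {Tp' : ℝ → ℝ} {ω ω' : Ω}

lemma Tp'_pos (h : S.Regular ω) (hT : S.IsDerivTp Tp') (hF : S.MonoRatio Tp') :
    0 < Tp' (Fdist S (S.ρ ω)) :=
  hT.pos_of_Finv hF h.2.1 h.2.2.1 (by rw [h.FinvE_Fdist]; exact EReal.coe_pos.2 h.1)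

lemma ratio_pos (h : S.Regular ω) (hT : S.IsDerivTp Tp') (hF : S.MonoRatio Tp') :
    0 < S.ratio Tp' ω :=
  div_pos h.1 (h.Tp'_pos hT hF)

lemma ratio_mul (h : S.Regular ω) (hT : S.IsDerivTp Tp') (hF : S.MonoRatio Tp') :
    S.ratio Tp' ω * Tp' (Fdist S (S.ρ ω)) = S.ρ ω :=
  div_mul_cancel₀ _ (h.Tp'_pos hT hF).ne'

lemma ratio_le (h : S.Regular ω) (h' : S.Regular ω') (hT : S.IsDerivTp Tp')
    (hF : S.MonoRatio Tp') (hle : S.ρ ω' ≤ S.ρ ω) : S.ratio Tp' ω' ≤ S.ratio Tp' ω := by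
  have h1 := hF _ _ h'.2.1 (S.Fdist_mono hle) h.2.2.1.le
  rw [h.FinvE_Fdist, h'.FinvE_Fdist, ← EReal.coe_mul, ← EReal.coe_mul,
    EReal.coe_le_coe_iff] at h1
  exact (div_le_div_iff₀ (h'.Tp'_pos hT hF) (h.Tp'_pos hT hF)).2 h1

end Regular

lemma IsDerivTp.aemeasurable_ratio {S : BSetup Ω} {Tp' : ℝ → ℝ} (hT : S.IsDerivTp Tp') :
    AEMeasurable (S.ratio Tp') S.P :=
  S.meas_ρ.aemeasurable.div hT.aemeasurable

lemma measurable_up_max (S : BSetup Ω) : Measurable fun x => S.up (max x 0) :=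
  Monotone.measurable fun _ _ h =>
    S.up_mono.monotoneOn (mem_Ici.2 (le_max_right _ _)) (mem_Ici.2 (le_max_right _ _))
      (max_le_max h le_rfl)

/-- The gap between `u₊(0)` and `u₊(0+)`. -/
def upJump (S : BSetup Ω) : Set ℝ := {y | 0 < y ∧ ∀ x, 0 < x → y < S.up x}

lemma measurableSet_upJump (S : BSetup Ω) : MeasurableSet S.upJump :=
  OrdConnected.measurableSet
    ⟨fun _ ha _ hb _ hx => ⟨ha.1.trans_le hx.1, fun z hz => hx.2.trans_lt (hb.2 z hz)⟩⟩

lemma isPreconnected_up_image (S : BSetup Ω) : IsPreconnected (S.up '' Ioi 0) :=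
  isPreconnected_Ioi.image _ fun x hx => (S.up_deriv x hx).continuousAt.continuousWithinAt

lemma lt_of_notMem_upJump (S : BSetup Ω) {y : ℝ} (hy : 0 < y) (h1 : y ∉ S.upJump)
    (h2 : y ∉ S.up '' Ioi 0) {x : ℝ} (hx : 0 ≤ x) : S.up x < y := by
  rcases hx.eq_or_lt with rfl | hx
  · rwa [S.up_zero]
  by_contra! hle
  simp only [upJump, mem_ofPred_eq, not_and, not_forall, not_lt] at h1
  obtain ⟨z, hz, hzy⟩ := h1 hy
  exact h2 (S.isPreconnected_up_image.ordConnected.out (mem_image_of_mem _ hz)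
    (mem_image_of_mem _ hx) ⟨hzy, hle⟩)

/-- The change of variables `y = u₊(x)` in the definition of `V₊`. -/
lemma Vpl_eq (S : BSetup Ω) {Y : Ω → ℝ} (hY : ∀ᵐ ω ∂S.P, 0 ≤ Y ω) :
    Vpl S Y = volume S.upJump * ENNReal.ofReal (S.Tp (S.P.real {ω | 0 < Y ω})) +
      ∫⁻ x in Ioi 0, ENNReal.ofReal (S.up' x) *
        ENNReal.ofReal (S.Tp (S.P.real {ω | x < Y ω})) := by
  set g : ℝ → ℝ≥0∞ := fun y => ENNReal.ofReal (S.Tp (S.P.real {ω | y < S.up (Y ω)})) with hg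
  have hsub : S.upJump ∪ S.up '' Ioi 0 ⊆ Ioi 0 := by
    rintro y (hy | ⟨x, hx, rfl⟩)
    · exact hy.1
    · exact S.up_pos hx
  have hm : MeasurableSet (S.up '' Ioi 0) :=
    S.isPreconnected_up_image.ordConnected.measurableSet
  have hdisj : Disjoint S.upJump (S.up '' Ioi 0) := by
    rw [Set.disjoint_left]
    rintro _ hy ⟨x, hx, rfl⟩
    exact (hy.2 x hx).false
  have hzero : ∀ y ∈ Ioi 0 \ (S.upJump ∪ S.up '' Ioi 0), g y = 0 := by
    intro y hy
    have hy2 := not_or.1 hy.2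
    have : S.P.real {ω | y < S.up (Y ω)} = 0 := by
      rw [measureReal_eq_zero_iff]
      refine measure_eq_zero_iff_ae_notMem.2 ?_
      filter_upwards [hY] with ω hω
      exact (S.lt_of_notMem_upJump hy.1 hy2.1 hy2.2 hω).not_gt
    rw [hg]
    simp only [this, S.Tp_zero, ENNReal.ofReal_zero]
  have hV : Vpl S Y = ∫⁻ y in Ioi 0, g y := rfl
  have hU : MeasurableSet (S.upJump ∪ S.up '' Ioi 0) := S.measurableSet_upJump.union hm
  rw [hV, ← lintegral_inter_add_sdiff _ _ hU, inter_eq_right.2 hsub,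
    setLIntegral_congr_fun (measurableSet_Ioi.diff hU) hzero, lintegral_zero, add_zero,
    lintegral_union hm hdisj]
  congr 1
  · have : ∀ y ∈ S.upJump, g y = ENNReal.ofReal (S.Tp (S.P.real {ω | 0 < Y ω})) := by
      intro y hy
      have hset : {ω | y < S.up (Y ω)} =ᵐ[S.P] {ω | 0 < Y ω} := by
        rw [eventuallyEq_set]
        filter_upwards [hY] with ω hω
        refine ⟨fun h => hω.lt_of_ne fun h0 => ?_, fun h => hy.2 _ h⟩
        simp only [← h0, S.up_zero] at h
        exact hy.1.not_gt h
      rw [hg]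
      simp only [measureReal_congr hset]
    rw [setLIntegral_congr_fun S.measurableSet_upJump this, setLIntegral_const, mul_comm]
  · rw [lintegral_image_eq_lintegral_abs_deriv_mul measurableSet_Ioi
      (fun x hx => (S.up_deriv x hx).hasDerivWithinAt)
      (S.up_mono.injOn.mono Ioi_subset_Ici_self)]
    refine setLIntegral_congr_fun measurableSet_Ioi fun x hx => ?_
    have hset : {ω | S.up x < S.up (Y ω)} =ᵐ[S.P] {ω | x < Y ω} := by
      rw [eventuallyEq_set]
      filter_upwards [hY] with ω hω
      exact S.up_mono.lt_iff_lt (mem_Ici.2 (le_of_lt hx)) (mem_Ici.2 hω)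
    rw [hg, abs_of_pos (S.up'_pos hx)]
    simp only [measureReal_congr hset]

lemma lintegral_priceMeasure_lt (S : BSetup Ω) {Y : Ω → ℝ} (hm : AEMeasurable Y S.P)
    (hY : ∀ᵐ ω ∂S.P, 0 ≤ Y ω) (hint : Integrable (fun ω => S.ρ ω * Y ω) S.P) :
    ∫⁻ x in Ioi 0, S.priceMeasure {ω | x < Y ω} = ENNReal.ofReal (∫ ω, S.ρ ω * Y ω ∂S.P) := by
  rw [← lintegral_eq_lintegral_meas_lt _ (S.priceMeasure_ac.ae_le hY)
    (hm.mono_ac S.priceMeasure_ac), priceMeasure,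
    lintegral_withDensity_eq_lintegral_mul₀ S.meas_ρ.ennreal_ofReal.aemeasurable hm.ennreal_ofReal,
    ofReal_integral_eq_lintegral_ofReal hint]
  · refine lintegral_congr_ae ?_
    filter_upwards [S.ρ_pos] with ω hω
    rw [Pi.mul_apply, ENNReal.ofReal_mul hω.le]
  · filter_upwards [S.ρ_pos, hY] with ω h1 h2 using mul_nonneg h1.le h2

/-- The candidate `(u₊')⁻¹(λρ/T₊'(F(ρ)))·1_{ρ≤c}`. -/
def cand (S : BSetup Ω) (Tp' I : ℝ → ℝ) (c : EReal) (l : ℝ) (ω : Ω) : ℝ :=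
  if (S.ρ ω : EReal) ≤ c then I (l * S.ρ ω / Tp' (Fdist S (S.ρ ω))) else 0

section Candidate

variable {S : BSetup Ω} {Tp' I : ℝ → ℝ} {c : EReal} {l : ℝ}

lemma cand_of_mem {ω : Ω} (h : ω ∈ lev S c) :
    S.cand Tp' I c l ω = I (l * S.ratio Tp' ω) := by
  rw [cand, ratio, mul_div_assoc]
  exact if_pos h

lemma cand_of_notMem {ω : Ω} (h : ω ∉ lev S c) : S.cand Tp' I c l ω = 0 := if_neg h

lemma cand_pos (hI : S.IsInvUp' I) (hT : S.IsDerivTp Tp') (hF : S.MonoRatio Tp') (hl : 0 < l)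
    {ω : Ω} (hω : S.Regular ω) (h : ω ∈ lev S c) : 0 < S.cand Tp' I c l ω := by
  rw [cand_of_mem h]
  exact (hI _ (mul_pos hl (hω.ratio_pos hT hF))).1

lemma cand_nonneg (hI : S.IsInvUp' I) (hT : S.IsDerivTp Tp') (hF : S.MonoRatio Tp') (hl : 0 < l)
    {ω : Ω} (hω : S.Regular ω) : 0 ≤ S.cand Tp' I c l ω := by
  by_cases h : ω ∈ lev S c
  · exact (cand_pos hI hT hF hl hω h).le
  · exact (cand_of_notMem h).ge

lemma cand_anti (hI : S.IsInvUp' I) (hT : S.IsDerivTp Tp') (hF : S.MonoRatio Tp') (hl : 0 < l)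
    {ω ω' : Ω} (hω : S.Regular ω) (hω' : S.Regular ω') (hle : S.ρ ω' ≤ S.ρ ω) :
    S.cand Tp' I c l ω ≤ S.cand Tp' I c l ω' := by
  by_cases h : ω ∈ lev S c
  · rw [cand_of_mem h, cand_of_mem (S.isLowerEvent_lev c ω ω' hω hω' h hle)]
    refine hI.strictAntiOn.antitoneOn (mul_pos hl (hω'.ratio_pos hT hF))
      (mul_pos hl (hω.ratio_pos hT hF)) ?_
    exact mul_le_mul_of_nonneg_left (hω.ratio_le hω' hT hF hle) hl.le
  · rw [cand_of_notMem h]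
    exact cand_nonneg hI hT hF hl hω'

lemma aemeasurable_cand (hI : S.IsInvUp' I) (hT : S.IsDerivTp Tp') (hF : S.MonoRatio Tp')
    (hl : 0 < l) : AEMeasurable (S.cand Tp' I c l) S.P := by
  have h : AEMeasurable
      ((lev S c).indicator fun ω => (Ioi 0).indicator I (l * S.ratio Tp' ω)) S.P :=
    (hI.measurable_indicator.comp_aemeasurable (hT.aemeasurable_ratio.const_mul l)).indicator
      (S.measurableSet_lev c)
  refine h.congr ?_
  filter_upwards [S.ae_regular] with ω hω
  by_cases hc : ω ∈ lev S c
  · rw [indicator_of_mem hc, cand_of_mem hc,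
      indicator_of_mem (mem_Ioi.2 (mul_pos hl (hω.ratio_pos hT hF)))]
  · rw [indicator_of_notMem hc, cand_of_notMem hc]

/-- For each level `x`, the event `{x < X*}` maximizes the Lagrangian among the events contained in
`{ρ ≤ c}`. -/
lemma lagrangian_le (hI : S.IsInvUp' I) (hT : S.IsDerivTp Tp') (hF : S.MonoRatio Tp')
    (hl : 0 < l) {A : Set Ω} (hA : NullMeasurableSet A S.P) (hAc : A ≤ᵐ[S.P] lev S c)
    {x : ℝ} (hx : 0 < x) :
    ENNReal.ofReal (S.up' x) * ENNReal.ofReal (S.Tp (S.P.real A)) +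
        ENNReal.ofReal l * S.priceMeasure {ω | x < S.cand Tp' I c l ω} ≤
      ENNReal.ofReal (S.up' x) * ENNReal.ofReal (S.Tp (S.P.real {ω | x < S.cand Tp' I c l ω})) +
        ENNReal.ofReal l * S.priceMeasure A := by
  set D := {ω | x < S.cand Tp' I c l ω} with hD
  have hDm : NullMeasurableSet D S.P :=
    nullMeasurableSet_lt aemeasurable_const (aemeasurable_cand hI hT hF hl)
  have hDlow : S.IsLowerEvent D := fun ω ω' hω hω' h hle =>
    lt_of_lt_of_le h (cand_anti hI hT hF hl hω hω' hle)
  obtain ⟨b, hb⟩ := S.exists_measure_lev_eq A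
  set B := lev S b with hB
  have hBm : MeasurableSet B := S.measurableSet_lev b
  have hBc : B ≤ᵐ[S.P] lev S c := by
    rcases le_total b c with hbc | hbc
    · exact Eventually.of_forall fun ω (hω : _ ≤ b) => le_trans hω hbc
    · refine (ae_eq_of_subset_of_measure_ge (fun ω (hω : _ ≤ c) => le_trans hω hbc) ?_
        (S.measurableSet_lev c).nullMeasurableSet (measure_ne_top _ _)).symm.le
      exact hb.le.trans (measure_mono_ae hAc)
  have hTA : ENNReal.ofReal (S.Tp (S.P.real A)) = S.distMeasure Tp' B := by
    rw [hT.distMeasure_lower (S.isLowerEvent_lev b) hBm.nullMeasurableSet, measureReal_def,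
      measureReal_def, hb]
  have hDm1 := hDm.mono_ac (S.distMeasure_ac Tp')
  have hDm2 := hDm.mono_ac S.priceMeasure_ac
  rw [hTA, ← hT.distMeasure_lower hDlow hDm]
  have h1 : ENNReal.ofReal (S.up' x) * S.distMeasure Tp' (B \ D) ≤
      ENNReal.ofReal l * S.priceMeasure (B \ D) := by
    simp only [distMeasure, priceMeasure, withDensity_apply']
    rw [← lintegral_const_mul' _ _ ENNReal.ofReal_ne_top,
      ← lintegral_const_mul' _ _ ENNReal.ofReal_ne_top]
    refine lintegral_mono_ae ?_
    rw [ae_restrict_iff'₀ (hBm.nullMeasurableSet.diff hDm)]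
    filter_upwards [S.ae_regular, hBc] with ω hω hωc hωB
    rw [← ENNReal.ofReal_mul (S.up'_pos hx).le, ← ENNReal.ofReal_mul hl.le]
    refine ENNReal.ofReal_le_ofReal ?_
    have h := hωB.2
    rw [hD, mem_ofPred_eq, cand_of_mem (hωc hωB.1),
      hI.lt_iff hx (mul_pos hl (hω.ratio_pos hT hF)), not_lt] at h
    calc S.up' x * Tp' (Fdist S (S.ρ ω))
        ≤ l * S.ratio Tp' ω * Tp' (Fdist S (S.ρ ω)) :=
          mul_le_mul_of_nonneg_right h (hω.Tp'_pos hT hF).le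
      _ = l * S.ρ ω := by rw [mul_assoc, hω.ratio_mul hT hF]
  have h2 : ENNReal.ofReal l * S.priceMeasure (D \ B) ≤
      ENNReal.ofReal (S.up' x) * S.distMeasure Tp' (D \ B) := by
    simp only [distMeasure, priceMeasure, withDensity_apply']
    rw [← lintegral_const_mul' _ _ ENNReal.ofReal_ne_top,
      ← lintegral_const_mul' _ _ ENNReal.ofReal_ne_top]
    refine lintegral_mono_ae ?_
    rw [ae_restrict_iff'₀ (hDm.diff hBm.nullMeasurableSet)]
    filter_upwards [S.ae_regular] with ω hω hωD
    rw [← ENNReal.ofReal_mul (S.up'_pos hx).le, ← ENNReal.ofReal_mul hl.le]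
    refine ENNReal.ofReal_le_ofReal ?_
    have h := hωD.1
    by_cases hc : ω ∈ lev S c
    · rw [hD, mem_ofPred_eq, cand_of_mem hc,
        hI.lt_iff hx (mul_pos hl (hω.ratio_pos hT hF))] at h
      calc l * S.ρ ω = l * S.ratio Tp' ω * Tp' (Fdist S (S.ρ ω)) := by
            rw [mul_assoc, hω.ratio_mul hT hF]
        _ ≤ S.up' x * Tp' (Fdist S (S.ρ ω)) :=
            mul_le_mul_of_nonneg_right h.le (hω.Tp'_pos hT hF).le
    · rw [hD, mem_ofPred_eq, cand_of_notMem hc] at h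
      exact absurd h hx.not_gt
  calc ENNReal.ofReal (S.up' x) * S.distMeasure Tp' B + ENNReal.ofReal l * S.priceMeasure D
      = ENNReal.ofReal (S.up' x) * S.distMeasure Tp' (B ∩ D) +
          ENNReal.ofReal l * S.priceMeasure (B ∩ D) +
          (ENNReal.ofReal (S.up' x) * S.distMeasure Tp' (B \ D) +
          ENNReal.ofReal l * S.priceMeasure (D \ B)) := by
        rw [← measure_inter_add_sdiff₀ B hDm1, ← measure_inter_add_sdiff D hBm, inter_comm D B]
        ring
    _ ≤ ENNReal.ofReal (S.up' x) * S.distMeasure Tp' (B ∩ D) +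
          ENNReal.ofReal l * S.priceMeasure (B ∩ D) +
          (ENNReal.ofReal l * S.priceMeasure (B \ D) +
          ENNReal.ofReal (S.up' x) * S.distMeasure Tp' (D \ B)) := by gcongr
    _ = ENNReal.ofReal (S.up' x) * S.distMeasure Tp' D +
          ENNReal.ofReal l * S.priceMeasure B := by
        rw [← measure_inter_add_sdiff₀ B hDm2, ← measure_inter_add_sdiff D hBm, inter_comm D B]
        ring
    _ ≤ _ := by
        gcongr _ + _ * ?_
        exact S.priceMeasure_lev_le hA hb

lemma Vpl_le_cand (hI : S.IsInvUp' I) (hT : S.IsDerivTp Tp') (hF : S.MonoRatio Tp')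
    (hl : 0 < l) {xp : ℝ} (hX : FeasPos S (lev S c) xp (S.cand Tp' I c l)) {Y : Ω → ℝ}
    (hY : FeasPos S (lev S c) xp Y) : Vpl S Y ≤ Vpl S (S.cand Tp' I c l) := by
  obtain ⟨hXm, hX0, hXi, hXx, -⟩ := hX
  obtain ⟨hYm, hY0, hYi, hYx, hYc⟩ := hY
  have hsub : ∀ x : ℝ, 0 ≤ x → {ω | x < Y ω} ≤ᵐ[S.P] lev S c := by
    intro x hx
    filter_upwards [hYc] with ω hω hlt
    by_contra h
    exact hx.not_gt (hω h ▸ hlt)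
  have hanti : ∀ Z : Ω → ℝ,
      Measurable fun x : ℝ => ENNReal.ofReal l * S.priceMeasure {ω | x < Z ω} :=
    fun Z => (Antitone.measurable fun a b hab =>
      measure_mono fun ω (hω : b < Z ω) => hab.trans_lt hω).const_mul _
  have hmain := setLIntegral_mono' (μ := volume) (measurableSet_Ioi (a := (0:ℝ))) fun x hx =>
    lagrangian_le (c := c) hI hT hF hl (nullMeasurableSet_lt aemeasurable_const hYm)
      (hsub x (le_of_lt hx)) hx
  rw [lintegral_add_right _ (hanti _), lintegral_add_right _ (hanti _),
    lintegral_const_mul' _ _ ENNReal.ofReal_ne_top, lintegral_const_mul' _ _ ENNReal.ofReal_ne_top,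
    S.lintegral_priceMeasure_lt hXm hX0 hXi, S.lintegral_priceMeasure_lt hYm hY0 hYi, hXx, hYx,
    ENNReal.add_le_add_iff_right (by finiteness)] at hmain
  rw [S.Vpl_eq hX0, S.Vpl_eq hY0]
  gcongr
  refine S.Tp_mono.monotoneOn ⟨measureReal_nonneg, measureReal_le_one (μ := S.P)⟩
    ⟨measureReal_nonneg, measureReal_le_one (μ := S.P)⟩ ?_
  refine ENNReal.toReal_mono (measure_ne_top _ _) (measure_mono_ae ?_)
  filter_upwards [S.ae_regular, hsub 0 le_rfl] with ω hω hωc hlt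
  exact cand_pos hI hT hF hl hω (hωc hlt)

lemma aemeasurable_up_cand (hI : S.IsInvUp' I) (hT : S.IsDerivTp Tp') (hF : S.MonoRatio Tp')
    (hl : 0 < l) : AEMeasurable (fun ω => S.up (S.cand Tp' I c l ω)) S.P := by
  refine (S.measurable_up_max.comp_aemeasurable (aemeasurable_cand (c := c) hI hT hF hl)).congr ?_
  filter_upwards [S.ae_regular] with ω hω
  rw [Function.comp_apply, max_eq_left (cand_nonneg hI hT hF hl hω)]

lemma Vpl_cand (hI : S.IsInvUp' I) (hT : S.IsDerivTp Tp') (hF : S.MonoRatio Tp') (hl : 0 < l) :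
    Vpl S (S.cand Tp' I c l) =
      ∫⁻ ω, ENNReal.ofReal (S.up (S.cand Tp' I c l ω) * Tp' (Fdist S (S.ρ ω))) ∂S.P := by
  have hm := aemeasurable_up_cand (c := c) hI hT hF hl
  have hnn : ∀ᵐ ω ∂S.P, 0 ≤ S.up (S.cand Tp' I c l ω) := by
    filter_upwards [S.ae_regular] with ω hω using S.up_nonneg (cand_nonneg hI hT hF hl hω)
  have h1 : Vpl S (S.cand Tp' I c l) =
      ∫⁻ y in Ioi 0, S.distMeasure Tp' {ω | y < S.up (S.cand Tp' I c l ω)} := by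
    refine lintegral_congr fun y => ?_
    rw [hT.distMeasure_lower ?_ (nullMeasurableSet_lt aemeasurable_const hm)]
    · rfl
    · exact fun ω ω' hω hω' h hle => lt_of_lt_of_le h <|
        S.up_mono.monotoneOn (cand_nonneg hI hT hF hl hω) (cand_nonneg hI hT hF hl hω')
          (cand_anti hI hT hF hl hω hω' hle)
  rw [h1, ← lintegral_eq_lintegral_meas_lt _ ((S.distMeasure_ac Tp').ae_le hnn)
    (hm.mono_ac (S.distMeasure_ac Tp')), distMeasure,
    lintegral_withDensity_eq_lintegral_mul₀ hT.aemeasurable.ennreal_ofReal hm.ennreal_ofReal]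
  refine lintegral_congr_ae ?_
  filter_upwards [hnn] with ω hω
  rw [Pi.mul_apply, mul_comm, ENNReal.ofReal_mul hω]

end Candidate

lemma measure_lev_ne_zero (S : BSetup Ω) {c : EReal} (hc : rhoLow S < c) : S.P (lev S c) ≠ 0 := by
  intro h
  refine hc.not_ge (le_essInf_of_ae_le c ?_)
  filter_upwards [measure_eq_zero_iff_ae_notMem.1 h] with ω hω using (not_le.1 hω).le

lemma measure_lev_rhoLow (S : BSetup Ω) : S.P (lev S (rhoLow S)) = 0 := by
  have h : ∀ e : EReal, ∀ᵐ ω ∂S.P, (S.ρ ω : EReal) ≠ e := by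
    intro e
    induction e with
    | bot => exact Eventually.of_forall fun ω => EReal.coe_ne_bot _
    | top => exact Eventually.of_forall fun ω => EReal.coe_ne_top _
    | coe r =>
      filter_upwards [measure_eq_zero_iff_ae_notMem.1 (S.ρ_atomless r)] with ω hω h
      exact hω (EReal.coe_eq_coe_iff.1 h)
  rw [measure_eq_zero_iff_ae_notMem]
  filter_upwards [h (rhoLow S), ae_essInf_le (μ := S.P) (f := fun ω => (S.ρ ω : EReal))]
    with ω hω hle hmem
  exact hω (le_antisymm hmem hle)

section Candidate

variable {S : BSetup Ω} {Tp' I : ℝ → ℝ} {c : EReal} {l : ℝ}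

lemma cand_le (hI : S.IsInvUp' I) (hT : S.IsDerivTp Tp') (hF : S.MonoRatio Tp') (hl : 0 < l)
    {ω : Ω} (hω : S.Regular ω) : S.cand Tp' I c l ω ≤ I (l * S.ratio Tp' ω) := by
  by_cases h : ω ∈ lev S c
  · exact (cand_of_mem h).le
  · rw [cand_of_notMem h]
    exact (hI _ (mul_pos hl (hω.ratio_pos hT hF))).1.le

/-- `u₊((u₊')⁻¹(ρ/T₊'(F(ρ))))·T₊'(F(ρ))` is integrable. -/
def IntegrableUtility (S : BSetup Ω) (Tp' I : ℝ → ℝ) : Prop :=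
  Integrable (fun ω => S.up (I (S.ρ ω / Tp' (Fdist S (S.ρ ω)))) * Tp' (Fdist S (S.ρ ω))) S.P

lemma integrable_mul_cand (hI : S.IsInvUp' I) (hT : S.IsDerivTp Tp') (hF : S.MonoRatio Tp')
    (hrisk : 0 < Filter.liminf (fun x : ℝ => -x * S.up'' x / S.up' x) Filter.atTop)
    (hu : S.IntegrableUtility Tp' I) (hl : 0 < l) :
    Integrable (fun ω => S.ρ ω * S.cand Tp' I c l ω) S.P := by
  obtain ⟨k, C, hk, hkC⟩ := hI.exists_le_mul_add hrisk hl
  refine ((hu.const_mul k).add (S.ρ_int.mul_const C)).mono'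
    (S.meas_ρ.aemeasurable.mul (aemeasurable_cand hI hT hF hl)).aestronglyMeasurable ?_
  filter_upwards [S.ae_regular] with ω hω
  have hr := hω.ratio_pos hT hF
  rw [Real.norm_of_nonneg (mul_nonneg hω.1.le (cand_nonneg hI hT hF hl hω)), Pi.add_apply]
  calc S.ρ ω * S.cand Tp' I c l ω
      ≤ S.ρ ω * (k * I (S.ratio Tp' ω) + C) :=
        mul_le_mul_of_nonneg_left ((cand_le hI hT hF hl hω).trans (hkC _ hr)) hω.1.le
    _ = k * ((S.ratio Tp' ω * I (S.ratio Tp' ω)) * Tp' (Fdist S (S.ρ ω))) + S.ρ ω * C := by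
        rw [mul_right_comm (S.ratio Tp' ω), hω.ratio_mul hT hF]
        ring
    _ ≤ k * (S.up (I (S.ratio Tp' ω)) * Tp' (Fdist S (S.ρ ω))) + S.ρ ω * C := by
        gcongr
        · exact (hω.Tp'_pos hT hF).le
        · exact hI.mul_le_up hr

lemma integral_mul_cand_lt (hI : S.IsInvUp' I) (hT : S.IsDerivTp Tp') (hF : S.MonoRatio Tp')
    (hrisk : 0 < Filter.liminf (fun x : ℝ => -x * S.up'' x / S.up' x) Filter.atTop)
    (hu : S.IntegrableUtility Tp' I) (hc : S.P (lev S c) ≠ 0) {l₁ l₂ : ℝ} (hl : 0 < l₁)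
    (hlt : l₁ < l₂) :
    ∫ ω, S.ρ ω * S.cand Tp' I c l₂ ω ∂S.P < ∫ ω, S.ρ ω * S.cand Tp' I c l₁ ω ∂S.P := by
  have hlt' : ∀ ω, S.Regular ω → ω ∈ lev S c → S.cand Tp' I c l₂ ω < S.cand Tp' I c l₁ ω := by
    intro ω hω hm
    have hr := hω.ratio_pos hT hF
    rw [cand_of_mem hm, cand_of_mem hm]
    exact hI.strictAntiOn (mul_pos hl hr) (mul_pos (hl.trans hlt) hr)
      (mul_lt_mul_of_pos_right hlt hr)
  have hle : (fun ω => S.ρ ω * S.cand Tp' I c l₂ ω) ≤ᵐ[S.P]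
      fun ω => S.ρ ω * S.cand Tp' I c l₁ ω := by
    filter_upwards [S.ae_regular] with ω hω
    refine mul_le_mul_of_nonneg_left ?_ hω.1.le
    by_cases hm : ω ∈ lev S c
    · exact (hlt' ω hω hm).le
    · rw [cand_of_notMem hm, cand_of_notMem hm]
  have hi₁ := integrable_mul_cand (c := c) hI hT hF hrisk hu hl
  have hi₂ := integrable_mul_cand (c := c) hI hT hF hrisk hu (hl.trans hlt)
  refine (integral_mono_ae hi₂ hi₁ hle).lt_of_ne fun h => hc ?_
  rw [integral_eq_iff_of_ae_le hi₂ hi₁ hle] at h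
  rw [measure_eq_zero_iff_ae_notMem]
  filter_upwards [S.ae_regular, h] with ω hω h hm
  exact (hlt' ω hω hm).ne (mul_left_cancel₀ hω.1.ne' h)

lemma continuousOn_integral_mul_cand (hI : S.IsInvUp' I) (hT : S.IsDerivTp Tp')
    (hF : S.MonoRatio Tp')
    (hrisk : 0 < Filter.liminf (fun x : ℝ => -x * S.up'' x / S.up' x) Filter.atTop)
    (hu : S.IntegrableUtility Tp' I) :
    ContinuousOn (fun l => ∫ ω, S.ρ ω * S.cand Tp' I c l ω ∂S.P) (Ioi 0) := by
  intro l hl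
  have hl : 0 < l := hl
  refine ContinuousAt.continuousWithinAt (continuousAt_of_dominated ?_ ?_
    (integrable_mul_cand (c := ⊤) hI hT hF hrisk hu (half_pos hl)) ?_)
  · filter_upwards [Ioi_mem_nhds hl] with l' hl'
    exact (integrable_mul_cand hI hT hF hrisk hu hl').aestronglyMeasurable
  · filter_upwards [Ioi_mem_nhds (half_lt_self hl)] with l' hl'
    have hl'0 : 0 < l' := (half_pos hl).trans hl'
    filter_upwards [S.ae_regular] with ω hω
    have hr := hω.ratio_pos hT hF
    rw [Real.norm_of_nonneg (mul_nonneg hω.1.le (cand_nonneg hI hT hF hl'0 hω)),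
      cand_of_mem (c := ⊤) (S.lev_top ▸ mem_univ ω)]
    refine mul_le_mul_of_nonneg_left ((cand_le hI hT hF hl'0 hω).trans ?_) hω.1.le
    exact hI.strictAntiOn.antitoneOn (mul_pos (half_pos hl) hr) (mul_pos hl'0 hr)
      (mul_le_mul_of_nonneg_right (le_of_lt hl') hr.le)
  · filter_upwards [S.ae_regular] with ω hω
    have hr := hω.ratio_pos hT hF
    refine continuousAt_const.mul ?_
    by_cases hm : ω ∈ lev S c
    · simp only [cand_of_mem hm]
      exact ContinuousAt.comp' (hI.continuousAt (mul_pos hl hr)) (by fun_prop)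
    · simp only [cand_of_notMem hm]
      exact continuousAt_const

lemma tendsto_integral_mul_cand (hI : S.IsInvUp' I) (hT : S.IsDerivTp Tp')
    (hF : S.MonoRatio Tp')
    (hrisk : 0 < Filter.liminf (fun x : ℝ => -x * S.up'' x / S.up' x) Filter.atTop)
    (hu : S.IntegrableUtility Tp' I) :
    Tendsto (fun l => ∫ ω, S.ρ ω * S.cand Tp' I c l ω ∂S.P) atTop (nhds 0) := by
  rw [← integral_zero Ω ℝ (μ := S.P)]
  refine tendsto_integral_filter_of_dominated_convergence _ ?_ ?_
    (integrable_mul_cand (c := ⊤) hI hT hF hrisk hu one_pos) ?_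
  · filter_upwards [eventually_gt_atTop 0] with l hl
    exact (integrable_mul_cand hI hT hF hrisk hu hl).aestronglyMeasurable
  · filter_upwards [eventually_ge_atTop 1] with l hl
    have hl0 : 0 < l := one_pos.trans_le hl
    filter_upwards [S.ae_regular] with ω hω
    have hr := hω.ratio_pos hT hF
    rw [Real.norm_of_nonneg (mul_nonneg hω.1.le (cand_nonneg hI hT hF hl0 hω)),
      cand_of_mem (c := ⊤) (S.lev_top ▸ mem_univ ω)]
    refine mul_le_mul_of_nonneg_left ((cand_le hI hT hF hl0 hω).trans ?_) hω.1.le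
    exact hI.strictAntiOn.antitoneOn (mul_pos one_pos hr) (mul_pos hl0 hr)
      (mul_le_mul_of_nonneg_right hl hr.le)
  · filter_upwards [S.ae_regular] with ω hω
    have hr := hω.ratio_pos hT hF
    rw [← mul_zero (S.ρ ω)]
    refine Tendsto.const_mul _ ?_
    by_cases hm : ω ∈ lev S c
    · simp only [cand_of_mem hm]
      exact hI.tendsto_atTop.comp (tendsto_id.atTop_mul_const hr)
    · simp only [cand_of_notMem hm]
      exact tendsto_const_nhds

lemma exists_le_integral_mul_cand (hI : S.IsInvUp' I) (hT : S.IsDerivTp Tp')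
    (hF : S.MonoRatio Tp')
    (hrisk : 0 < Filter.liminf (fun x : ℝ => -x * S.up'' x / S.up' x) Filter.atTop)
    (hu : S.IntegrableUtility Tp' I) (hc : S.P (lev S c) ≠ 0) {x : ℝ} (hx : 0 < x) :
    ∃ l, 0 < l ∧ x ≤ ∫ ω, S.ρ ω * S.cand Tp' I c l ω ∂S.P := by
  obtain ⟨n, hn⟩ : ∃ n : ℕ, S.P (lev S c ∩ {ω | S.ratio Tp' ω ≤ n}) ≠ 0 := by
    by_contra! h
    refine hc (measure_mono_null (fun ω hω => ?_) (measure_iUnion_null h))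
    obtain ⟨n, hn⟩ := exists_nat_ge (S.ratio Tp' ω)
    exact mem_iUnion.2 ⟨n, hω, hn⟩
  set D := lev S c ∩ {ω | S.ratio Tp' ω ≤ n}
  have hD : NullMeasurableSet D S.P := (S.measurableSet_lev c).nullMeasurableSet.inter
    (nullMeasurableSet_le hT.aemeasurable_ratio aemeasurable_const)
  have hpos : 0 < ∫ ω in D, S.ρ ω ∂S.P := by
    have h0 : 0 ≤ᵐ[S.P.restrict D] S.ρ :=
      ae_restrict_of_ae (S.ρ_pos.mono fun ω hω => le_of_lt hω)
    refine (integral_nonneg_of_ae h0).lt_of_ne fun h => hn ?_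
    rw [eq_comm, integral_eq_zero_iff_of_nonneg_ae h0 S.ρ_int.integrableOn] at h
    rw [← Measure.restrict_eq_zero, ← ae_eq_bot]
    refine eventually_false_iff_eq_bot.1 ?_
    filter_upwards [h, ae_restrict_of_ae S.ρ_pos] with ω h1 h2
    exact h2.ne' h1
  have hn0 : (0:ℝ) < n := by
    obtain ⟨ω, hω, hr⟩ : ∃ ω, ω ∈ D ∧ S.Regular ω := by
      by_contra! h
      refine hn (measure_mono_null (fun ω hω => h ω hω) S.ae_regular)
    exact (hr.ratio_pos hT hF).trans_le hω.2
  set y := x / ∫ ω in D, S.ρ ω ∂S.P with hy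
  have hy0 : 0 < y := div_pos hx hpos
  have hl : 0 < S.up' y / n := div_pos (S.up'_pos hy0) hn0
  refine ⟨S.up' y / n, hl, ?_⟩
  have hint := integrable_mul_cand (c := c) hI hT hF hrisk hu hl
  calc x = ∫ ω in D, S.ρ ω * y ∂S.P := by
        rw [integral_mul_const, hy, mul_div_cancel₀ _ hpos.ne']
    _ ≤ ∫ ω in D, S.ρ ω * S.cand Tp' I c (S.up' y / n) ω ∂S.P := by
        refine integral_mono_ae (S.ρ_int.integrableOn.mul_const y) hint.integrableOn ?_
        filter_upwards [ae_restrict_of_ae S.ae_regular, ae_restrict_mem₀ hD] with ω hω hωD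
        have hr := hω.ratio_pos hT hF
        refine mul_le_mul_of_nonneg_left ?_ hω.1.le
        rw [cand_of_mem hωD.1]
        nth_rewrite 1 [← hI.apply_up' hy0]
        refine hI.strictAntiOn.antitoneOn (mul_pos hl hr) (S.up'_pos hy0) ?_
        rw [div_mul_eq_mul_div, div_le_iff₀ hn0]
        exact mul_le_mul_of_nonneg_left hωD.2 (S.up'_pos hy0).le
    _ ≤ ∫ ω, S.ρ ω * S.cand Tp' I c (S.up' y / n) ω ∂S.P := by
        refine setIntegral_le_integral hint ?_
        filter_upwards [S.ae_regular] with ω hω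
          using mul_nonneg hω.1.le (cand_nonneg hI hT hF hl hω)

lemma exists_integral_mul_cand_eq (hI : S.IsInvUp' I) (hT : S.IsDerivTp Tp')
    (hF : S.MonoRatio Tp')
    (hrisk : 0 < Filter.liminf (fun x : ℝ => -x * S.up'' x / S.up' x) Filter.atTop)
    (hu : S.IntegrableUtility Tp' I) (hc : S.P (lev S c) ≠ 0) {x : ℝ} (hx : 0 < x) :
    ∃ l, 0 < l ∧ ∫ ω, S.ρ ω * S.cand Tp' I c l ω ∂S.P = x := by
  obtain ⟨a, ha, hxa⟩ := exists_le_integral_mul_cand hI hT hF hrisk hu hc hx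
  obtain ⟨b, hb, hxb⟩ := ((eventually_gt_atTop 0).and
    ((tendsto_integral_mul_cand (c := c) hI hT hF hrisk hu).eventually (gt_mem_nhds hx))).exists
  exact isPreconnected_Ioi.intermediate_value hb ha
    (continuousOn_integral_mul_cand hI hT hF hrisk hu) ⟨hxb.le, hxa⟩

lemma coe_Vpl_cand (hI : S.IsInvUp' I) (hT : S.IsDerivTp Tp') (hF : S.MonoRatio Tp')
    (hl : 0 < l) (hfin : Vpl S (S.cand Tp' I c l) < ⊤) :
    (Vpl S (S.cand Tp' I c l)).toEReal =
      ((∫ ω, (if (S.ρ ω : EReal) ≤ c then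
          S.up (I (l * S.ρ ω / Tp' (Fdist S (S.ρ ω)))) * Tp' (Fdist S (S.ρ ω))
        else 0) ∂S.P : ℝ) : EReal) := by
  have hmeas : AEMeasurable (fun ω => S.up (S.cand Tp' I c l ω) * Tp' (Fdist S (S.ρ ω))) S.P :=
    (aemeasurable_up_cand hI hT hF hl).mul hT.aemeasurable
  have hnn : ∀ᵐ ω ∂S.P, 0 ≤ S.up (S.cand Tp' I c l ω) * Tp' (Fdist S (S.ρ ω)) := by
    filter_upwards [S.ae_regular] with ω hω
    exact mul_nonneg (S.up_nonneg (cand_nonneg hI hT hF hl hω)) (hω.Tp'_pos hT hF).le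
  have heq : (fun ω => if (S.ρ ω : EReal) ≤ c then
      S.up (I (l * S.ρ ω / Tp' (Fdist S (S.ρ ω)))) * Tp' (Fdist S (S.ρ ω)) else 0) =
      fun ω => S.up (S.cand Tp' I c l ω) * Tp' (Fdist S (S.ρ ω)) := by
    ext ω
    by_cases h : (S.ρ ω : EReal) ≤ c
    · rw [if_pos h, cand, if_pos h]
    · rw [if_neg h, cand, if_neg h, S.up_zero, zero_mul]
  rw [heq, integral_eq_lintegral_of_nonneg_ae hnn hmeas.aestronglyMeasurable,
    ← Vpl_cand hI hT hF hl, EReal.coe_ennreal_toReal hfin.ne]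

end Candidate

lemma Vpl_eq_zero (S : BSetup Ω) {Y : Ω → ℝ} (hY : Y =ᵐ[S.P] 0) : Vpl S Y = 0 := by
  have h0 : ∀ x : ℝ, 0 ≤ x → S.P.real {ω | x < Y ω} = 0 := by
    intro x hx
    rw [measureReal_eq_zero_iff, measure_eq_zero_iff_ae_notMem]
    filter_upwards [hY] with ω hω
    rw [hω]
    exact hx.not_gt
  rw [S.Vpl_eq (hY.mono fun ω hω => hω.ge), h0 0 le_rfl, S.Tp_zero, ENNReal.ofReal_zero, mul_zero,
    zero_add]
  refine setLIntegral_eq_zero measurableSet_Ioi fun x hx => ?_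
  rw [h0 x (le_of_lt hx), S.Tp_zero, ENNReal.ofReal_zero, mul_zero, Pi.zero_apply]

lemma vPos_eq_of_optPos (S : BSetup Ω) {A : Set Ω} {xp : ℝ} {X : Ω → ℝ} (hA : S.P A ≠ 0)
    (hX : OptPos S A xp X) : vPos S A xp = (Vpl S X).toEReal := by
  rw [vPos, if_neg hA]
  refine IsLUB.sSup_eq (IsGreatest.isLUB ⟨⟨X, hX.1, rfl⟩, ?_⟩)
  rintro _ ⟨Y, hY, rfl⟩
  exact EReal.coe_ennreal_le_coe_ennreal_iff.2 (hX.2 Y hY)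

lemma optPos_zero (S : BSetup Ω) (A : Set Ω) : OptPos S A 0 fun _ => 0 := by
  refine ⟨⟨aemeasurable_const, by simp, by simp, by simp, by simp⟩, ?_⟩
  rintro Y ⟨-, hY0, hYi, hYx, -⟩
  have h0 : 0 ≤ᵐ[S.P] fun ω => S.ρ ω * Y ω := by
    filter_upwards [S.ρ_pos, hY0] with ω h1 h2 using mul_nonneg h1.le h2
  rw [integral_eq_zero_iff_of_nonneg_ae h0 hYi] at hYx
  refine (S.Vpl_eq_zero ?_).le.trans zero_le
  filter_upwards [S.ρ_pos, hYx] with ω h1 h2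
  exact (mul_eq_zero.1 h2).resolve_left h1.ne'

lemma vPos_zero (S : BSetup Ω) (A : Set Ω) : vPos S A 0 = 0 := by
  by_cases hA : S.P A = 0
  · rw [vPos, if_pos hA, if_pos rfl]
  · rw [S.vPos_eq_of_optPos hA (S.optPos_zero A), S.Vpl_eq_zero (Y := fun _ => 0) EventuallyEq.rfl]
    rfl

lemma not_feasPos_of_measure_eq_zero (S : BSetup Ω) {A : Set Ω} {xp : ℝ} (hA : S.P A = 0)
    (hx : xp ≠ 0) {X : Ω → ℝ} : ¬ FeasPos S A xp X := by
  rintro ⟨-, -, -, hXx, hXA⟩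
  refine hx (hXx.symm.trans (integral_eq_zero_of_ae ?_))
  filter_upwards [measure_eq_zero_iff_ae_notMem.1 hA, hXA] with ω h1 h2
  rw [h2 h1, mul_zero, Pi.zero_apply]

end BSetup

/-- Theorem 6.1: solution of the positive part problem under
Assumption (Fdec).  Here `Tp'` is the derivative of `T₊` and `I = (u₊')⁻¹`. -/
theorem positive_part_solution (S : BSetup Ω) (hfin : FinCond S)
    (Tp' : ℝ → ℝ)
    (hTp' : ∀ x ∈ Set.Icc (0:ℝ) 1, HasDerivWithinAt S.Tp (Tp' x) (Set.Icc 0 1) x)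
    (I : ℝ → ℝ) (hI : ∀ y : ℝ, 0 < y → 0 < I y ∧ S.up' (I y) = y)
    -- Assumption (Fdec), part 1: `F⁻¹(z)/T₊'(z)` is nondecreasing on `(0,1]`.
    (hFdec1 : ∀ z₁ z₂ : ℝ, 0 < z₁ → z₁ ≤ z₂ → z₂ ≤ 1 →
      FinvE S z₁ * ((Tp' z₂ : ℝ) : EReal) ≤ FinvE S z₂ * ((Tp' z₁ : ℝ) : EReal))
    -- Assumption (Fdec), part 2: `liminf_{x→∞} (−x u₊''(x)/u₊'(x)) > 0`.
    (hFdec2 : 0 < Filter.liminf (fun x : ℝ => -x * S.up'' x / S.up' x) Filter.atTop)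
    -- Assumption (Fdec), part 3: `E[u₊((u₊')⁻¹(ρ/T₊'(F(ρ))))·T₊'(F(ρ))] < ∞`.
    (hFdec3 : MeasureTheory.Integrable
      (fun ω => S.up (I (S.ρ ω / Tp' (Fdist S (S.ρ ω)))) * Tp' (Fdist S (S.ρ ω))) S.P)
    (c : EReal) (hc1 : rhoLow S ≤ c) (hc2 : c ≤ rhoBar S)
    (xp : ℝ) (hxp : max S.x0 0 ≤ xp) :
    -- (i)
    (xp = 0 → OptPos S (lev S c) 0 (fun _ => 0) ∧ vPos S (lev S c) 0 = 0) ∧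
    -- (ii)
    (0 < xp → c = rhoLow S →
      (¬ ∃ X : Ω → ℝ, FeasPos S (lev S c) xp X) ∧ vPos S (lev S c) xp = ⊥) ∧
    -- (iii)
    (0 < xp → rhoLow S < c →
      ∃ l : ℝ, 0 < l ∧
        (∫ ω, S.ρ ω *
          (if (S.ρ ω : EReal) ≤ c then I (l * S.ρ ω / Tp' (Fdist S (S.ρ ω))) else 0)
            ∂S.P) = xp ∧
        (∀ l' : ℝ, 0 < l' →
          (∫ ω, S.ρ ω *
            (if (S.ρ ω : EReal) ≤ c then I (l' * S.ρ ω / Tp' (Fdist S (S.ρ ω))) else 0)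
              ∂S.P) = xp → l' = l) ∧
        OptPos S (lev S c) xp
          (fun ω => if (S.ρ ω : EReal) ≤ c then I (l * S.ρ ω / Tp' (Fdist S (S.ρ ω))) else 0) ∧
        vPos S (lev S c) xp =
          ((∫ ω, (if (S.ρ ω : EReal) ≤ c then
              S.up (I (l * S.ρ ω / Tp' (Fdist S (S.ρ ω)))) * Tp' (Fdist S (S.ρ ω))
            else 0) ∂S.P : ℝ) : EReal)) := by
  change S.IsInvUp' I at hI
  change S.IsDerivTp Tp' at hTp'
  change S.MonoRatio Tp' at hFdec1
  change S.IntegrableUtility Tp' I at hFdec3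
  refine ⟨fun _ => ⟨S.optPos_zero _, S.vPos_zero _⟩, ?_, ?_⟩
  · rintro hx rfl
    have h0 := S.measure_lev_rhoLow
    refine ⟨fun ⟨X, hX⟩ => S.not_feasPos_of_measure_eq_zero h0 hx.ne' hX, ?_⟩
    rw [vPos, if_pos h0, if_neg hx.ne']
  · intro hx hc
    have h0 := S.measure_lev_ne_zero hc
    obtain ⟨l, hl, hlx⟩ := BSetup.exists_integral_mul_cand_eq hI hTp' hFdec1 hFdec2 hFdec3 h0 hx
    have hint := BSetup.integrable_mul_cand (c := c) hI hTp' hFdec1 hFdec2 hFdec3 hl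
    have hm : AEMeasurable (S.cand Tp' I c l) S.P := BSetup.aemeasurable_cand hI hTp' hFdec1 hl
    have hnn : ∀ᵐ ω ∂S.P, 0 ≤ S.cand Tp' I c l ω := by
      filter_upwards [S.ae_regular] with ω hω using BSetup.cand_nonneg hI hTp' hFdec1 hl hω
    have hfeas : FeasPos S (lev S c) xp (S.cand Tp' I c l) :=
      ⟨hm, hnn, hint, hlx, Eventually.of_forall fun ω hω => BSetup.cand_of_notMem hω⟩
    have hopt : OptPos S (lev S c) xp (S.cand Tp' I c l) :=
      ⟨hfeas, fun Y hY => BSetup.Vpl_le_cand hI hTp' hFdec1 hl hfeas hY⟩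
    refine ⟨l, hl, hlx, fun l' hl' hlx' => ?_, hopt, ?_⟩
    · rcases lt_trichotomy l' l with h | h | h
      · exact absurd (hlx.trans hlx'.symm)
          (BSetup.integral_mul_cand_lt hI hTp' hFdec1 hFdec2 hFdec3 h0 hl' h).ne
      · exact h
      · exact absurd (hlx'.trans hlx.symm)
          (BSetup.integral_mul_cand_lt hI hTp' hFdec1 hFdec2 hFdec3 h0 hl h).ne
    · rw [S.vPos_eq_of_optPos h0 hopt]
      exact BSetup.coe_Vpl_cand hI hTp' hFdec1 hl (hfin _ hm hnn hint)

end
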